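/- arXiv:2302.01869 — 3 statements merged into one kernel-verified Lean document; each statement's English description precedes it below -/
import Mathlib

section
/- For every n ∈ ℤ⁺, every admissible α, and all integers 0 ≤ m ≤ ℓ ≤ n with ℓ + m < n, the elementary symmetric polynomial of operators S^{ℓ,m}_{[0,n−1]} is a constant multiple of the identity: there exists γ ∈ ℂ with S^{ℓ,m}_{[0,n−1]} = γ·I. -/
noncomputable section

abbrev Hqw : Type := lp (fun _ : ℤ => ℂ) 2
abbrev Op : Type := Hqw →L[ℂ] Hqw

noncomputable def δ (j : ℤ) : Hqw := lp.single 2 j 1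

def coord (ψ : Hqw) (i : ℤ) : ℂ := ψ i

/-- `B δ_j = δ_{j-1} - δ_{j+1}`. -/
def IsB (B : Op) : Prop := ∀ j : ℤ, B (δ j) = δ (j - 1) - δ (j + 1)

/-- `C δ_{2j} = δ_{2j+2}`, `C δ_{2j+1} = δ_{2j-1}`. -/
def IsC (C : Op) : Prop :=
  ∀ j : ℤ, C (δ (2 * j)) = δ (2 * j + 2) ∧ C (δ (2 * j + 1)) = δ (2 * j - 1)

/-- the position sequence: `x_{2j} = x_{2j+1} = |j|`. -/
def IsPos (x : ℤ → ℝ) : Prop :=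
  ∀ j : ℤ, x (2 * j) = |(j : ℝ)| ∧ x (2 * j + 1) = |(j : ℝ)|

/-- `K` is the commutator `[X, A]`, i.e. `⟨δ_i, K δ_j⟩ = (x_i - x_j) ⟨δ_i, A δ_j⟩`. -/
def IsXComm (x : ℤ → ℝ) (A K : Op) : Prop :=
  ∀ i j : ℤ, coord (K (δ j)) i = ((x i - x j : ℝ) : ℂ) * coord (A (δ j)) i

/-- a local field: a diagonal unitary `D δ_j = e^{iθ_j} δ_j`. -/
def IsLocalField (D : Op) : Prop :=
  ∃ θ : ℤ → ℝ, ∀ j : ℤ, D (δ j) = Complex.exp ((θ j : ℂ) * Complex.I) • δ j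

/-- `U_t = r² I + r t B + t² C` with `r = √(1 - t²)`. -/
def Ut (t : ℝ) (B C : Op) : Op :=
  (((Real.sqrt (1 - t ^ 2)) ^ 2 : ℝ) : ℂ) • (1 : Op) +
    ((Real.sqrt (1 - t ^ 2) * t : ℝ) : ℂ) • B + ((t ^ 2 : ℝ) : ℂ) • C

/-- `⟨X⟩_ψ = Σ_j x_j |⟨δ_j, ψ⟩|²`. -/
def Xexp (x : ℤ → ℝ) (ψ : Hqw) : ℝ := ∑' j : ℤ, x j * ‖coord ψ j‖ ^ 2

/-- a unit vector supported on `span{δ₀, δ₁}`. -/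
def IsInit (Ψ : Hqw) : Prop := ‖Ψ‖ = 1 ∧ ∃ a b : ℂ, Ψ = a • δ 0 + b • δ 1

/-- `α = e^{2πik/n}` with `k ∈ ℤ⁺`, `gcd(k,n) = 1`, `α ≠ 1`. -/
def IsAdmissible (n : ℕ) (α : ℂ) : Prop :=
  α ≠ 1 ∧ ∃ k : ℕ, 0 < k ∧ Nat.gcd k n = 1 ∧
    α = Complex.exp (((2 * Real.pi * k / n : ℝ) : ℂ) * Complex.I)

/-- the `n`-periodic field `D_n δ_j = α^j δ_j`. -/
def IsDn (α : ℂ) (D : Op) : Prop := ∀ j : ℤ, D (δ j) = α ^ j • δ j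

/-- `B^{(j)} = D_n^j B D_n^{-j}`, explicitly `B^{(j)} δ_i = α^{-j} δ_{i-1} - α^{j} δ_{i+1}`. -/
def IsBj (α : ℂ) (j : ℤ) (Bj : Op) : Prop :=
  ∀ i : ℤ, Bj (δ i) = α ^ (-j) • δ (i - 1) - α ^ j • δ (i + 1)

/-- `C^{(j)} = D_n^j C D_n^{-j}`, explicitly `C^{(j)} δ_{2i} = α^{2j} δ_{2i+2}`,
`C^{(j)} δ_{2i+1} = α^{-2j} δ_{2i-1}`. -/
def IsCj (α : ℂ) (j : ℤ) (Cj : Op) : Prop :=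
  ∀ i : ℤ, Cj (δ (2 * i)) = α ^ (2 * j) • δ (2 * i + 2) ∧
    Cj (δ (2 * i + 1)) = α ^ (-(2 * j)) • δ (2 * i - 1)

-- the elementary symmetric polynomial of operators `S^{ℓ,m}_{[a, n-1]}`:
-- sum over `a ≤ j₁ < … < j_ℓ ≤ n-1` and `η ∈ {0,1}^ℓ` with `|η| = m` of the ordered
-- products `A_{η₁}^{(j₁)} ⋯ A_{η_ℓ}^{(j_ℓ)}`, where `A_1 = C`, `A_0 = B`.
open Classical in
noncomputable def Sop (Bf Cf : ℤ → Op) (a n ℓ m : ℕ) : Op :=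
  ∑ p : (Fin ℓ → Fin n) × (Fin ℓ → Bool),
    if StrictMono p.1 ∧ (∀ k, a ≤ (p.1 k : ℕ)) ∧
        (Finset.univ.filter fun k => p.2 k = true).card = m then
      (List.ofFn fun k : Fin ℓ =>
        if p.2 k = true then Cf ((p.1 k : ℕ) : ℤ) else Bf ((p.1 k : ℕ) : ℤ)).prod
    else 0

lemma op_ext {F : Type*} [AddCommMonoid F] [Module ℂ F] [TopologicalSpace F] [T2Space F]
    {f g : Hqw →L[ℂ] F} (h : ∀ i, f (δ i) = g (δ i)) : f = g := by
  apply lp.ext_continuousLinearMap (by simp)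
  intro i
  ext
  simpa [δ] using h i

lemma coord_delta (j i : ℤ) : coord (δ j) i = if i = j then 1 else 0 := by
  unfold coord δ
  by_cases h : i = j
  · subst h; simp
  · rw [lp.single_apply_ne _ _ _ h]; simp [h]

/-- coordinate functional -/
def cf (i : ℤ) : Hqw →L[ℂ] ℂ := lp.evalCLM ℂ (fun _ : ℤ => ℂ) 2 i

lemma cf_apply (i : ℤ) (ψ : Hqw) : cf i ψ = coord ψ i := rfl

lemma cf_delta (i j : ℤ) : cf i (δ j) = if i = j then 1 else 0 := coord_delta j i

lemma B_row {α : ℂ} {j : ℤ} {Bj : Op} (h : IsBj α j Bj) (ψ : Hqw) (k : ℤ) :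
    cf k (Bj ψ) = α ^ (-j) * cf (k + 1) ψ - α ^ j * cf (k - 1) ψ := by
  have : (cf k).comp Bj = α ^ (-j) • cf (k + 1) - α ^ j • cf (k - 1) := by
    apply op_ext
    intro i
    simp only [ContinuousLinearMap.comp_apply, h i, map_sub, map_smul, cf_delta,
      ContinuousLinearMap.sub_apply, ContinuousLinearMap.smul_apply]
    have e1 : (k = i - 1) ↔ (k + 1 = i) := by omega
    have e2 : (k = i + 1) ↔ (k - 1 = i) := by omega
    simp only [e1, e2]
  exact congrArg (fun f => f ψ) this

lemma C_col {α : ℂ} {j : ℤ} {Cj : Op} (h : IsCj α j Cj) (k : ℤ) :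
    Cj (δ k) = if Even k then α ^ (2 * j) • δ (k + 2) else α ^ (-(2 * j)) • δ (k - 2) := by
  rcases Int.even_or_odd' k with ⟨i, rfl | rfl⟩
  · simp [(h i).1]
  · rw [(h i).2, if_neg (by simp [Int.even_add, parity_simps])]
    congr 2; ring

lemma C_row {α : ℂ} {j : ℤ} {Cj : Op} (h : IsCj α j Cj) (ψ : Hqw) (k : ℤ) :
    cf k (Cj ψ) = if Even k then α ^ (2 * j) * cf (k - 2) ψ
      else α ^ (-(2 * j)) * cf (k + 2) ψ := by
  have : (cf k).comp Cj = if Even k then α ^ (2 * j) • cf (k - 2)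
      else α ^ (-(2 * j)) • cf (k + 2) := by
    apply op_ext
    intro i
    simp only [ContinuousLinearMap.comp_apply, C_col h]
    by_cases hk : Even k <;> by_cases hi : Even i
    · have e2 : (k = i + 2) ↔ (k - 2 = i) := by omega
      simp [hk, hi, cf_delta, e2]
    · have e1 : k ≠ i - 2 := by rintro rfl; simp [parity_simps] at hk; contradiction
      have e2 : k - 2 ≠ i := by rintro rfl; exact hi (hk.sub (by decide))
      simp [hk, hi, cf_delta, e1, e2]
    · have e1 : k ≠ i + 2 := by rintro rfl; exact hk (hi.add (by decide))
      have e2 : k + 2 ≠ i := by rintro rfl; simp [parity_simps] at hi; contradiction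
      simp [hk, hi, cf_delta, e1, e2]
    · have e2 : (k = i - 2) ↔ (k + 2 = i) := by omega
      simp [hk, hi, cf_delta, e2]
  have h2 := congrArg (fun f => f ψ) this
  simp only [ContinuousLinearMap.comp_apply] at h2
  rw [h2]
  split_ifs <;> simp

/-- coefficients of the ordered product -/
def ee (Bf Cf : ℤ → Op) : List ℤ → ℤ → ℤ → Op
  | [], l, m => if l = 0 ∧ m = 0 then 1 else 0
  | j :: L, l, m => ee Bf Cf L l m + Bf j * ee Bf Cf L (l - 1) m
      + Cf j * ee Bf Cf L (l - 1) (m - 1)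

lemma ee_snoc (Bf Cf : ℤ → Op) (j : ℤ) (L : List ℤ) : ∀ l m : ℤ,
    ee Bf Cf (L ++ [j]) l m = ee Bf Cf L l m + ee Bf Cf L (l - 1) m * Bf j
      + ee Bf Cf L (l - 1) (m - 1) * Cf j := by
  induction L with
  | nil => intro l m; simp [ee]
  | cons i L ih =>
    intro l m
    simp only [List.cons_append, ee, ih]
    noncomm_ring

lemma ee_neg (Bf Cf : ℤ → Op) (L : List ℤ) : ∀ l m : ℤ, l < 0 → ee Bf Cf L l m = 0 := by
  induction L with
  | nil => intro l m h; simp [ee]; omega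
  | cons i L ih => intro l m h; simp [ee, ih _ _ h, ih (l - 1) _ (by omega)]

/-- consecutive integers -/
def rg : ℤ → ℕ → List ℤ
  | _, 0 => []
  | a, d + 1 => a :: rg (a + 1) d

lemma rg_snoc (d : ℕ) : ∀ a : ℤ, rg a (d + 1) = rg a d ++ [a + d] := by
  induction d with
  | zero => intro a; simp [rg]
  | succ d ih =>
    intro a
    rw [rg, ih, rg, List.cons_append]
    congr 3
    push_cast; ring

lemma rg_map_add (c : ℤ) (d : ℕ) : ∀ a : ℤ, (rg a d).map (· + c) = rg (a + c) d := by
  induction d with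
  | zero => intro a; simp [rg]
  | succ d ih =>
    intro a
    simp only [rg, List.map_cons, ih]
    congr 2; ring

lemma rg_flip (d : ℕ) : ∀ a : ℤ, ((rg a d).map (- ·)).reverse = rg (1 - a - d) d := by
  induction d with
  | zero => intro a; simp [rg]
  | succ d ih =>
    intro a
    rw [rg_snoc d (1 - a - _)]
    simp only [rg, List.map_cons, List.reverse_cons, ih]
    congr 2
    · push_cast; ring
    · congr 1; push_cast; ring

lemma mul_apply_op (A B : Op) (ψ : Hqw) : (A * B) ψ = A (B ψ) := rfl

section core
variable {α : ℂ} {Bf Cf : ℤ → Op}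

lemma v_cons (hBf : ∀ j : ℤ, IsBj α j (Bf j)) (hCf : ∀ j : ℤ, IsCj α j (Cf j))
    (j : ℤ) (L : List ℤ) (l m k i : ℤ) :
    cf i (ee Bf Cf (j :: L) l m (δ k)) = cf i (ee Bf Cf L l m (δ k))
      + (α ^ (-j) * cf (i + 1) (ee Bf Cf L (l - 1) m (δ k))
          - α ^ j * cf (i - 1) (ee Bf Cf L (l - 1) m (δ k)))
      + (if Even i then α ^ (2 * j) * cf (i - 2) (ee Bf Cf L (l - 1) (m - 1) (δ k))
          else α ^ (-(2 * j)) * cf (i + 2) (ee Bf Cf L (l - 1) (m - 1) (δ k))) := by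
  simp only [ee, ContinuousLinearMap.add_apply, mul_apply_op, map_add,
    B_row (hBf j), C_row (hCf j)]

lemma v_snoc (hBf : ∀ j : ℤ, IsBj α j (Bf j)) (hCf : ∀ j : ℤ, IsCj α j (Cf j))
    (j : ℤ) (L : List ℤ) (l m k i : ℤ) :
    cf i (ee Bf Cf (L ++ [j]) l m (δ k)) = cf i (ee Bf Cf L l m (δ k))
      + (α ^ (-j) * cf i (ee Bf Cf L (l - 1) m (δ (k - 1)))
          - α ^ j * cf i (ee Bf Cf L (l - 1) m (δ (k + 1))))
      + (if Even k then α ^ (2 * j) * cf i (ee Bf Cf L (l - 1) (m - 1) (δ (k + 2)))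
          else α ^ (-(2 * j)) * cf i (ee Bf Cf L (l - 1) (m - 1) (δ (k - 2)))) := by
  simp only [ee_snoc, ContinuousLinearMap.add_apply, mul_apply_op, map_add,
    hBf j k, C_col (hCf j)]
  split_ifs <;> simp

lemma v_nil (l m k i : ℤ) : cf i (ee Bf Cf [] l m (δ k)) =
    if l = 0 ∧ m = 0 then (if i = k then 1 else 0) else 0 := by
  simp only [ee]
  split_ifs <;> simp_all [cf_delta]

lemma v_band (hBf : ∀ j : ℤ, IsBj α j (Bf j)) (hCf : ∀ j : ℤ, IsCj α j (Cf j))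
    (L : List ℤ) : ∀ l m k i : ℤ, (l + m < i - k ∨ l + m < k - i) →
    cf i (ee Bf Cf L l m (δ k)) = 0 := by
  induction L with
  | nil =>
    intro l m k i h
    rw [v_nil]
    split_ifs <;> first | rfl | omega
  | cons j L ih =>
    intro l m k i h
    rw [v_cons hBf hCf, ih l m k i h, ih (l - 1) m k (i + 1) (by omega),
      ih (l - 1) m k (i - 1) (by omega), ih (l - 1) (m - 1) k (i - 2) (by omega),
      ih (l - 1) (m - 1) k (i + 2) (by omega)]
    simp

lemma v_rot (h0 : α ≠ 0) (hBf : ∀ j : ℤ, IsBj α j (Bf j)) (hCf : ∀ j : ℤ, IsCj α j (Cf j))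
    (L : List ℤ) : ∀ l m k i : ℤ,
    cf i (ee Bf Cf (L.map (· + 1)) l m (δ k)) = α ^ (i - k) * cf i (ee Bf Cf L l m (δ k)) := by
  induction L with
  | nil =>
    intro l m k i
    rw [List.map_nil, v_nil]
    split_ifs <;> simp_all
  | cons j L ih =>
    intro l m k i
    rw [List.map_cons, v_cons hBf hCf, v_cons hBf hCf]
    simp only [ih]
    have e1 : α ^ (-(j + 1)) * α ^ (i + 1 - k) = α ^ (i - k) * α ^ (-j) := by
      rw [← zpow_add₀ h0, ← zpow_add₀ h0]; congr 1; ring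
    have e2 : α ^ (j + 1) * α ^ (i - 1 - k) = α ^ (i - k) * α ^ j := by
      rw [← zpow_add₀ h0, ← zpow_add₀ h0]; congr 1; ring
    have e3 : α ^ (2 * (j + 1)) * α ^ (i - 2 - k) = α ^ (i - k) * α ^ (2 * j) := by
      rw [← zpow_add₀ h0, ← zpow_add₀ h0]; congr 1; ring
    have e4 : α ^ (-(2 * (j + 1))) * α ^ (i + 2 - k) = α ^ (i - k) * α ^ (-(2 * j)) := by
      rw [← zpow_add₀ h0, ← zpow_add₀ h0]; congr 1; ring
    simp only [← mul_assoc, e1, e2, e3, e4]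
    split_ifs <;> ring

lemma v_flip (hBf : ∀ j : ℤ, IsBj α j (Bf j)) (hCf : ∀ j : ℤ, IsCj α j (Cf j))
    (L : List ℤ) : ∀ l m k i : ℤ,
    cf (i + 1) (ee Bf Cf ((L.map (- ·)).reverse) l m (δ (k + 1)))
      = (-1 : ℂ) ^ (i + k) * cf k (ee Bf Cf L l m (δ i)) := by
  induction L with
  | nil =>
    intro l m k i
    rw [List.map_nil, List.reverse_nil, v_nil, v_nil]
    by_cases h : i = k
    · subst h
      simp [← two_mul, zpow_mul]
    · have hsymm : ¬ k = i := fun e => h e.symm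
      simp [h, hsymm]
  | cons j L ih =>
    intro l m k i
    rw [List.map_cons, List.reverse_cons, v_cons hBf hCf, v_snoc hBf hCf]
    have s0 := ih l m k i
    have s1 := ih (l - 1) m (k - 1) i
    have s2 := ih (l - 1) m (k + 1) i
    have s3 := ih (l - 1) (m - 1) (k + 2) i
    have s4 := ih (l - 1) (m - 1) (k - 2) i
    have h0 : (-1 : ℂ) ≠ 0 := by norm_num
    have p1 : (-1 : ℂ) ^ (i + (k - 1)) = - (-1 : ℂ) ^ (i + k) := by
      rw [← add_sub_assoc, zpow_sub₀ h0, zpow_one, div_neg, div_one]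
    have p2 : (-1 : ℂ) ^ (i + (k + 1)) = - (-1 : ℂ) ^ (i + k) := by
      rw [← add_assoc, zpow_add₀ h0]; simp
    have p3 : (-1 : ℂ) ^ (i + (k + 2)) = (-1 : ℂ) ^ (i + k) := by
      rw [← add_assoc, zpow_add₀ h0]; norm_num
    have p4 : (-1 : ℂ) ^ (i + (k - 2)) = (-1 : ℂ) ^ (i + k) := by
      rw [← add_sub_assoc, zpow_sub₀ h0]; norm_num
    rw [p1] at s1
    rw [p2] at s2
    rw [p3] at s3
    rw [p4] at s4
    rw [show k + 1 - 1 = k - 1 + 1 by ring, show k + 1 - 2 = k - 2 + 1 by ring,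
      show k + 1 + 2 = k + 2 + 1 by ring, s0, s1, s2, s3, s4]
    have q1 : -(2 * -j) = 2 * j := by ring
    have q2 : 2 * -j = -(2 * j) := by ring
    have q3 : Even (k + 1) ↔ ¬ Even k := by simp [parity_simps]
    rw [q1, q2, neg_neg]
    simp only [q3]
    split_ifs <;> first | contradiction | ring

lemma ee_period (hBf : ∀ j : ℤ, IsBj α j (Bf j)) (hCf : ∀ j : ℤ, IsCj α j (Cf j))
    (h0 : α ≠ 0) (n : ℤ) (hα : α ^ n = 1) :
    (∀ j, Bf (j + n) = Bf j) ∧ (∀ j, Cf (j + n) = Cf j) := by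
  have a1 : ∀ j, α ^ (j + n) = α ^ j := fun j => by rw [zpow_add₀ h0, hα, mul_one]
  have a2 : ∀ j, α ^ (2 * (j + n)) = α ^ (2 * j) := fun j => by
    rw [mul_comm, zpow_mul, a1, ← zpow_mul, mul_comm]
  constructor
  · intro j
    apply op_ext
    intro i
    rw [hBf, hBf, zpow_neg, zpow_neg, a1]
  · intro j
    apply op_ext
    intro i
    rw [C_col (hCf _), C_col (hCf _), zpow_neg, zpow_neg, a2]

lemma ee_map_period (n : ℤ) (hB : ∀ j, Bf (j + n) = Bf j) (hC : ∀ j, Cf (j + n) = Cf j)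
    (L : List ℤ) : ∀ l m, ee Bf Cf (L.map (· + n)) l m = ee Bf Cf L l m := by
  induction L with
  | nil => intro l m; rfl
  | cons j L ih => intro l m; simp only [List.map_cons, ee, ih, hB, hC]

lemma core_claim (n : ℕ) (hn : 0 < n) (hp : IsPrimitiveRoot α n)
    (hBf : ∀ j : ℤ, IsBj α j (Bf j)) (hCf : ∀ j : ℤ, IsCj α j (Cf j)) (N : ℕ) :
    ∀ l m : ℤ, l < N → l + m < n →
      ee Bf Cf (rg 1 n) l m = ee Bf Cf (rg 0 n) l m ∧
      ∃ γ : ℂ, ee Bf Cf (rg 0 n) l m = γ • (1 : Op) := by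
  have h0 : α ≠ 0 := hp.ne_zero hn.ne'
  obtain ⟨hB, hC⟩ := ee_period hBf hCf h0 n (by simpa using hp.pow_eq_one)
  induction N with
  | zero =>
    intro l m hl _
    have hlz : l < 0 := by simpa using hl
    rw [ee_neg _ _ _ _ _ hlz, ee_neg _ _ _ _ _ hlz]
    exact ⟨rfl, 0, by simp⟩
  | succ N ih =>
    intro l m hl hlm
    push_cast at hl
    obtain ⟨e1, γ1, g1⟩ := ih (l - 1) m (by omega) (by omega)
    obtain ⟨e2, γ2, g2⟩ := ih (l - 1) (m - 1) (by omega) (by omega)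
    have key : ee Bf Cf (rg 1 n) l m = ee Bf Cf (rg 0 n) l m := by
      have t2 : ee Bf Cf (rg 0 (n + 1)) l m = ee Bf Cf (rg 0 (n + 1)) l m := rfl
      conv_rhs at t2 => rw [rg_snoc, ee_snoc]
      rw [rg, ee, zero_add, e1, e2, g1, g2, hB 0, hC 0] at t2
      simpa using t2
    refine ⟨key, cf 0 (ee Bf Cf (rg 0 n) l m (δ 0)), ?_⟩
    have off : ∀ k i : ℤ, i ≠ k → cf i (ee Bf Cf (rg 0 n) l m (δ k)) = 0 := by
      intro k i hik
      by_cases hb : l + m < i - k ∨ l + m < k - i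
      · exact v_band hBf hCf _ _ _ _ _ hb
      · have r := v_rot h0 hBf hCf (rg 0 n) l m k i
        rw [rg_map_add, zero_add, key] at r
        have hne : α ^ (i - k) ≠ 1 := by
          rw [Ne, hp.zpow_eq_one_iff_dvd]
          intro hd
          have := Int.eq_zero_of_abs_lt_dvd hd (by rw [abs_lt]; constructor <;> omega)
          omega
        have r2 : (α ^ (i - k) - 1) * cf i (ee Bf Cf (rg 0 n) l m (δ k)) = 0 := by
          rw [sub_mul, one_mul, ← r, sub_self]
        rcases mul_eq_zero.1 r2 with h | h
        · exact absurd (sub_eq_zero.1 h) hne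
        · exact h
    have step : ∀ k : ℤ, cf (k + 1) (ee Bf Cf (rg 0 n) l m (δ (k + 1)))
        = cf k (ee Bf Cf (rg 0 n) l m (δ k)) := by
      intro k
      have f := v_flip hBf hCf (rg 0 n) l m k k
      rw [rg_flip, ← ee_map_period n hB hC, rg_map_add,
        show (1 - 0 - (n : ℤ) + n) = 1 by ring, key, ← two_mul, zpow_mul] at f
      simpa using f
    have diag : ∀ k : ℤ, cf k (ee Bf Cf (rg 0 n) l m (δ k))
        = cf 0 (ee Bf Cf (rg 0 n) l m (δ 0)) := by
      intro k
      induction k using Int.induction_on with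
      | zero => rfl
      | succ k ihk => rw [step, ihk]
      | pred k ihk => rw [← ihk, ← step (-k - 1)]; simp
    apply op_ext
    intro k
    apply lp.ext
    funext i
    change cf i (ee Bf Cf (rg 0 n) l m (δ k)) =
      cf i ((cf 0 (ee Bf Cf (rg 0 n) l m (δ 0)) • (1 : Op)) (δ k))
    rw [ContinuousLinearMap.smul_apply, ContinuousLinearMap.one_apply, map_smul, cf_delta]
    by_cases hik : i = k
    · subst hik; rw [diag]; simp
    · rw [off _ _ hik]; simp [hik]

end core

open Classical in
/-- `Sop` with an integer `m` -/
def SZ (Bf Cf : ℤ → Op) (a n l : ℕ) (m : ℤ) : Op :=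
  ∑ p : (Fin l → Fin n) × (Fin l → Bool),
    if StrictMono p.1 ∧ (∀ k, a ≤ (p.1 k : ℕ)) ∧
        ((Finset.univ.filter fun k => p.2 k = true).card : ℤ) = m then
      (List.ofFn fun k : Fin l =>
        if p.2 k = true then Cf ((p.1 k : ℕ) : ℤ) else Bf ((p.1 k : ℕ) : ℤ)).prod
    else 0

lemma Sop_eq (Bf Cf : ℤ → Op) (a n l m : ℕ) : Sop Bf Cf a n l m = SZ Bf Cf a n l m := by
  unfold Sop SZ
  simp only [Nat.cast_inj]

lemma SZ_zero (Bf Cf : ℤ → Op) (a n : ℕ) (m : ℤ) :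
    SZ Bf Cf a n 0 m = if m = 0 then 1 else 0 := by
  unfold SZ
  have : ∀ p : (Fin 0 → Fin n) × (Fin 0 → Bool), StrictMono p.1 := fun p i => i.elim0
  simp only [this, IsEmpty.forall_iff, true_and, Finset.univ_eq_empty, Finset.filter_empty,
    Finset.card_empty, List.ofFn_zero, List.prod_nil]
  simp [eq_comm (a := (0 : ℤ))]

lemma cons_cond {l n : ℕ} (a : ℕ) (j : Fin n) (f : Fin l → Fin n) :
    (StrictMono (Fin.cons j f : Fin (l + 1) → Fin n) ∧
      ∀ k, a ≤ ((Fin.cons j f : Fin (l + 1) → Fin n) k : ℕ)) ↔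
    (a ≤ (j : ℕ) ∧ StrictMono f ∧ ∀ k, (j : ℕ) + 1 ≤ (f k : ℕ)) := by
  constructor
  · rintro ⟨h1, h2⟩
    refine ⟨by simpa using h2 0, fun x y hxy => ?_, fun k => ?_⟩
    · simpa using h1 (Fin.succ_lt_succ_iff.2 hxy)
    · have := h1 (Fin.succ_pos k)
      simpa using this
  · rintro ⟨h1, h2, h3⟩
    constructor
    · intro x y hxy
      induction y using Fin.cases with
      | zero => exact absurd hxy (Fin.not_lt_zero x)
      | succ y =>
        induction x using Fin.cases with
        | zero => simpa using h3 y
        | succ x => simpa using h2 (Fin.succ_lt_succ_iff.1 hxy)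
    · intro k
      induction k using Fin.cases with
      | zero => simpa using h1
      | succ k => have := h3 k; simp; omega

lemma cons_card {l : ℕ} (b : Bool) (g : Fin l → Bool) :
    (Finset.univ.filter fun k => (Fin.cons b g : Fin (l + 1) → Bool) k = true).card
      = (if b = true then 1 else 0) + (Finset.univ.filter fun k => g k = true).card := by
  rw [Fin.card_filter_univ_succ]
  cases b <;> simp [add_comm]

lemma SZ_succ (Bf Cf : ℤ → Op) (a n l : ℕ) (m : ℤ) :
    SZ Bf Cf a n (l + 1) m = ∑ j : Fin n, if a ≤ (j : ℕ) then
      Bf (j : ℕ) * SZ Bf Cf (j + 1) n l m + Cf (j : ℕ) * SZ Bf Cf (j + 1) n l (m - 1) else 0 := by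
  classical
  let E : (Fin n × (Fin l → Fin n)) × (Bool × (Fin l → Bool)) ≃
      (Fin (l + 1) → Fin n) × (Fin (l + 1) → Bool) :=
    Equiv.prodCongr (Fin.consEquiv (fun _ => Fin n)) (Fin.consEquiv (fun _ => Bool))
  have hE : ∀ q, E q = (Fin.cons q.1.1 q.1.2, Fin.cons q.2.1 q.2.2) := fun q => rfl
  unfold SZ
  rw [← E.sum_comp]
  simp only [hE, ← and_assoc, cons_cond, cons_card]
  simp only [Fintype.sum_prod_type]
  apply Finset.sum_congr rfl
  intro j _
  by_cases ha : a ≤ (j : ℕ)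
  · simp only [Fintype.sum_bool, Finset.mul_sum, Finset.sum_add_distrib]
    rw [add_comm]
    simp only [ha, true_and, if_true]
    congr 1
    · refine Finset.sum_congr rfl fun f _ => Finset.sum_congr rfl fun g _ => ?_
      simp [List.ofFn_succ]
    · refine Finset.sum_congr rfl fun f _ => Finset.sum_congr rfl fun g _ => ?_
      simp [List.ofFn_succ, eq_sub_iff_add_eq, add_comm]
  · simp [ha]

lemma SZ_step (Bf Cf : ℤ → Op) (a n l : ℕ) (ha : a < n) (m : ℤ) :
    SZ Bf Cf a n (l + 1) m = SZ Bf Cf (a + 1) n (l + 1) m + Bf a * SZ Bf Cf (a + 1) n l m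
      + Cf a * SZ Bf Cf (a + 1) n l (m - 1) := by
  rw [SZ_succ, SZ_succ Bf Cf (a + 1)]
  let x : Fin n := ⟨a, ha⟩
  rw [← Finset.add_sum_erase _ _ (Finset.mem_univ x),
    ← Finset.add_sum_erase (a := x) _ _ (Finset.mem_univ x)]
  have : ∀ j ∈ Finset.univ.erase x, (a ≤ (j : ℕ) ↔ a + 1 ≤ (j : ℕ)) := by
    intro j hj
    have : (j : ℕ) ≠ a := fun h => (Finset.ne_of_mem_erase hj) (Fin.ext h)
    omega
  rw [Finset.sum_congr rfl fun j hj => if_congr (this j hj) rfl rfl]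
  simp only [x, le_refl, if_true, show ¬ (a + 1 ≤ a) by omega, if_false, zero_add]
  abel

lemma SZ_eq_ee (Bf Cf : ℤ → Op) (n : ℕ) (d : ℕ) : ∀ a : ℕ, a + d = n → ∀ (l : ℕ) (m : ℤ),
    SZ Bf Cf a n l m = ee Bf Cf (rg a d) l m := by
  induction d with
  | zero =>
    intro a ha l m
    cases l with
    | zero => rw [SZ_zero]; simp [rg, ee]
    | succ l =>
      rw [SZ_succ]
      rw [Finset.sum_eq_zero]
      · simp [rg, ee]; omega
      · intro j _
        rw [if_neg]; have := j.2; omega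
  | succ d ih =>
    intro a ha l m
    have ihh := ih (a + 1) (by omega)
    rw [rg, ee]
    cases l with
    | zero =>
      rw [ee_neg _ _ _ (((0 : ℕ) : ℤ) - 1) m (by simp), ee_neg _ _ _ (((0 : ℕ) : ℤ) - 1) _ (by simp)]
      have := ihh 0 m
      push_cast at this ⊢
      rw [← this, SZ_zero, SZ_zero]; simp
    | succ l =>
      rw [SZ_step _ _ _ _ _ (by omega), ihh, ihh, ihh]
      push_cast
      simp

/-- Theorem 4.1: for `0 ≤ m ≤ ℓ ≤ n` with `ℓ + m < n`,
`S^{ℓ,m}_{[0,n-1]}` is a constant multiple of the identity. -/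
theorem stmt11 (n : ℕ) (hn : 0 < n) (α : ℂ) (hα : IsAdmissible n α)
    (Bf Cf : ℤ → Op) (hBf : ∀ j : ℤ, IsBj α j (Bf j)) (hCf : ∀ j : ℤ, IsCj α j (Cf j))
    (l m : ℕ) (hm : m ≤ l) (hl : l ≤ n) (hlm : l + m < n) :
    ∃ γ : ℂ, Sop Bf Cf 0 n l m = γ • (1 : Op) := by
  obtain ⟨_, k, _, hk, rfl⟩ := hα
  have hp : IsPrimitiveRoot (Complex.exp (((2 * Real.pi * k / n : ℝ) : ℂ) * Complex.I)) n := by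
    convert Complex.isPrimitiveRoot_exp_of_coprime k n hn.ne' hk using 2
    push_cast; ring
  rw [Sop_eq, SZ_eq_ee Bf Cf n n 0 (by simp)]
  exact (core_claim n hn hp hBf hCf (l + 1) l m (by push_cast; omega) (by exact_mod_cast hlm)).2
end
end

section
/- For every n ∈ ℤ⁺, every admissible α, and all integers 0 ≤ m ≤ ℓ ≤ n, the commutator of the position operator with the elementary symmetric polynomial of operators satisfies ‖[X, S^{ℓ,m}_{[0,n−1]}]‖ ≤ 2^{ℓ−m} · ℓ · C(n,ℓ) · C(ℓ,m), where C(·,·) denotes the binomial coefficient. -/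
noncomputable section

theorem aux_hasSum (ψ : Hqw) : HasSum (fun i : ℤ => coord ψ i • δ i) ψ := by
  have h := lp.hasSum_single (p := 2) (by simp) ψ
  refine h.congr_fun ?_ |> fun h => h
  intro i
  unfold coord δ
  rw [← lp.single_smul]
  simp

theorem aux_ext {A A' : Op} (h : ∀ j, A (δ j) = A' (δ j)) : A = A' := by
  ext1 ψ
  have h1 := (aux_hasSum ψ).mapL A
  have h2 := (aux_hasSum ψ).mapL A'
  refine h1.unique ?_
  simpa [h] using h2

theorem aux_coord_hasSum (A : Op) (ψ : Hqw) (i : ℤ) :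
    HasSum (fun k : ℤ => coord (A (δ k)) i * coord ψ k) (coord (A ψ) i) := by
  have h1 := (aux_hasSum ψ).mapL A
  have hc : Continuous (fun x : Hqw => coord x i) :=
    (lp.lipschitzWith_one_eval (E := fun _ : ℤ => ℂ) 2 i).continuous
  let g : Hqw →+ ℂ := ⟨⟨fun x => coord x i, by simp [coord]⟩, by simp [coord]⟩
  have h2 := h1.map g hc
  refine h2.congr_fun ?_ |> fun h => h
  intro k
  simp [g, coord, mul_comm]

theorem aux_comm_unique {x : ℤ → ℝ} {A K K' : Op} (h : IsXComm x A K) (h' : IsXComm x A K') :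
    K = K' := by
  apply aux_ext
  intro j
  ext i
  exact (h i j).trans (h' i j).symm

theorem aux_comm_mul {x : ℤ → ℝ} {A K A' K' : Op} (h : IsXComm x A K) (h' : IsXComm x A' K') :
    IsXComm x (A * A') (K * A' + A * K') := by
  intro i j
  have h1 := (aux_coord_hasSum K (A' (δ j)) i).add (aux_coord_hasSum A (K' (δ j)) i)
  have h2 := (aux_coord_hasSum A (A' (δ j)) i).mul_left ((x i - x j : ℝ) : ℂ)
  have : coord ((K * A' + A * K') (δ j)) i = coord (K (A' (δ j))) i + coord (A (K' (δ j))) i := by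
    simp [coord]
  rw [this]
  refine h1.unique (h2.congr_fun ?_ |> fun h => h)
  intro k
  rw [h i k, h' k j]
  push_cast
  ring

theorem aux_comm_add {x : ℤ → ℝ} {A K A' K' : Op} (h : IsXComm x A K) (h' : IsXComm x A' K') :
    IsXComm x (A + A') (K + K') := by
  intro i j
  have e1 := h i j
  have e2 := h' i j
  simp only [coord, ContinuousLinearMap.add_apply, lp.coeFn_add, Pi.add_apply] at *
  rw [e1, e2]
  ring

theorem aux_comm_sub {x : ℤ → ℝ} {A K A' K' : Op} (h : IsXComm x A K) (h' : IsXComm x A' K') :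
    IsXComm x (A - A') (K - K') := by
  intro i j
  have e1 := h i j
  have e2 := h' i j
  simp only [coord, ContinuousLinearMap.sub_apply, lp.coeFn_sub, Pi.sub_apply] at *
  rw [e1, e2]
  ring

theorem aux_comm_zero {x : ℤ → ℝ} : IsXComm x 0 0 := by
  intro i j
  simp [coord]

theorem aux_comm_one {x : ℤ → ℝ} : IsXComm x 1 0 := by
  intro i j
  simp only [coord, δ, ContinuousLinearMap.zero_apply, ContinuousLinearMap.one_apply]
  by_cases hij : i = j
  · subst hij; simp
  · rw [lp.single_apply_ne _ _ _ hij]; simp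

theorem aux_comm_sum {x : ℤ → ℝ} {ι : Type*} (s : Finset ι) (A : ι → Op) (c : ι → ℝ)
    (h : ∀ i ∈ s, ∃ K, IsXComm x (A i) K ∧ ‖K‖ ≤ c i) :
    ∃ K, IsXComm x (∑ i ∈ s, A i) K ∧ ‖K‖ ≤ ∑ i ∈ s, c i := by
  classical
  induction s using Finset.induction_on with
  | empty => exact ⟨0, by simpa using aux_comm_zero, by simp⟩
  | insert a s ha ih =>
    obtain ⟨K, hK, hKn⟩ := ih (fun i hi => h i (Finset.mem_insert_of_mem hi))
    obtain ⟨K', hK', hKn'⟩ := h a (Finset.mem_insert_self _ _)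
    rw [Finset.sum_insert ha, Finset.sum_insert ha]
    exact ⟨K' + K, aux_comm_add hK' hK, (norm_add_le _ _).trans (add_le_add hKn' hKn)⟩

theorem aux_list {x : ℤ → ℝ} (l : ℕ) (A : Fin l → Op) (c : Fin l → ℝ)
    (hA : ∀ k, ‖A k‖ ≤ c k) (hK : ∀ k, ∃ K, IsXComm x (A k) K ∧ ‖K‖ ≤ c k) :
    ‖(List.ofFn A).prod‖ ≤ ∏ k, c k ∧
      ∃ K, IsXComm x (List.ofFn A).prod K ∧ ‖K‖ ≤ l * ∏ k, c k := by
  induction l with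
  | zero =>
    refine ⟨?_, 0, ?_, ?_⟩
    · rw [List.ofFn_zero, List.prod_nil, Fin.prod_univ_zero]
      exact ContinuousLinearMap.norm_id_le (𝕜 := ℂ) (E := Hqw)
    · simpa using aux_comm_one
    · simp
  | succ l ih =>
    obtain ⟨h1, K, hK1, hK2⟩ := ih (fun k => A k.succ) (fun k => c k.succ)
      (fun k => hA _) (fun k => hK _)
    obtain ⟨K', hK1', hK2'⟩ := hK 0
    have hc0 : 0 ≤ c 0 := (norm_nonneg _).trans (hA 0)
    rw [List.ofFn_succ, List.prod_cons, Fin.prod_univ_succ]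
    refine ⟨(norm_mul_le _ _).trans (mul_le_mul (hA 0) h1 (norm_nonneg _) hc0),
      _, aux_comm_mul hK1' hK1, (norm_add_le _ _).trans ?_⟩
    have e1 := (norm_mul_le K' (List.ofFn fun k => A k.succ).prod).trans
      (mul_le_mul hK2' h1 (norm_nonneg _) hc0)
    have e2 := (norm_mul_le (A 0) K).trans
      (mul_le_mul (hA 0) hK2 (norm_nonneg _) hc0)
    refine (add_le_add e1 e2).trans (le_of_eq ?_)
    push_cast
    ring

theorem aux_W (σ : Equiv.Perm ℤ) (w : ℤ → ℂ) (hw : ∀ j, ‖w j‖ ≤ 1) :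
    ∃ W : Op, ‖W‖ ≤ 1 ∧ ∀ j, W (δ j) = w j • δ (σ j) := by
  have hs : ∀ ψ : Hqw, Summable fun i => ‖ψ (σ.symm i)‖ ^ (2 : ENNReal).toReal := fun ψ =>
    (σ.symm.summable_iff (f := fun i => ‖ψ i‖ ^ (2 : ENNReal).toReal)).2
      ((lp.memℓp ψ).summable (by simp))
  have hle : ∀ (ψ : Hqw) i, ‖w (σ.symm i) * ψ (σ.symm i)‖ ^ (2 : ENNReal).toReal ≤
      ‖ψ (σ.symm i)‖ ^ (2 : ENNReal).toReal := by
    intro ψ i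
    apply Real.rpow_le_rpow (norm_nonneg _) _ (by simp)
    rw [norm_mul]
    exact mul_le_of_le_one_left (norm_nonneg _) (hw _)
  have hs' : ∀ ψ : Hqw, Summable fun i =>
      ‖w (σ.symm i) * ψ (σ.symm i)‖ ^ (2 : ENNReal).toReal := fun ψ =>
    Summable.of_nonneg_of_le (fun i => by positivity) (hle ψ) (hs ψ)
  let L : Hqw →ₗ[ℂ] Hqw :=
    { toFun := fun ψ => ⟨fun i => w (σ.symm i) * ψ (σ.symm i), memℓp_gen (hs' ψ)⟩
      map_add' := by
        intro a b
        ext i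
        exact mul_add _ _ _
      map_smul' := by
        intro a b
        ext i
        exact mul_left_comm _ _ _ }
  have hL : ∀ ψ, ‖L ψ‖ ≤ 1 * ‖ψ‖ := by
    intro ψ
    rw [one_mul]
    refine lp.norm_le_of_tsum_le (by simp) (norm_nonneg _) ?_
    rw [lp.norm_rpow_eq_tsum (by simp) ψ]
    rw [← σ.symm.tsum_eq (fun i => ‖ψ i‖ ^ (2 : ENNReal).toReal)]
    exact (hs' ψ).tsum_le_tsum (hle ψ) (hs ψ)
  refine ⟨L.mkContinuous 1 hL, L.mkContinuous_norm_le zero_le_one hL, ?_⟩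
  intro j
  ext i
  change w (σ.symm i) * δ j (σ.symm i) = w j * δ (σ j) i
  unfold δ
  by_cases h : i = σ j
  · subst h; simp
  · rw [lp.single_apply_ne _ _ _ h, lp.single_apply_ne]
    · simp
    · intro h'; apply h; rw [← h']; simp

theorem aux_W_comm {x : ℤ → ℝ} (σ : Equiv.Perm ℤ) (w : ℤ → ℂ) (hw : ∀ j, ‖w j‖ ≤ 1)
    (hx : ∀ j, |x (σ j) - x j| ≤ 1) :
    ∃ W K : Op, ‖W‖ ≤ 1 ∧ (∀ j, W (δ j) = w j • δ (σ j)) ∧ IsXComm x W K ∧ ‖K‖ ≤ 1 := by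
  obtain ⟨W, hW, hWj⟩ := aux_W σ w hw
  obtain ⟨K, hK, hKj⟩ := aux_W σ (fun j => ((x (σ j) - x j : ℝ) : ℂ) * w j) (by
    intro j
    rw [norm_mul, Complex.norm_real]
    exact mul_le_one₀ (hx j) (norm_nonneg _) (hw j))
  refine ⟨W, K, hW, hWj, ?_, hK⟩
  intro i j
  rw [hWj, hKj]
  simp only [coord, δ, lp.coeFn_smul, Pi.smul_apply, smul_eq_mul]
  by_cases h : i = σ j
  · subst h; simp
  · rw [lp.single_apply_ne _ _ _ h]; simp

theorem aux_abs_diff (a b : ℤ) (h : |(a : ℝ) - b| ≤ 1) : |(|(a : ℝ)| - |(b : ℝ)|)| ≤ 1 :=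
  (abs_abs_sub_abs_le _ _).trans h

theorem aux_x_succ {x : ℤ → ℝ} (hx : IsPos x) (j : ℤ) : |x (j + 1) - x j| ≤ 1 := by
  rcases Int.even_or_odd' j with ⟨k, rfl | rfl⟩
  · rw [(hx k).1, (hx k).2]; simp
  · rw [show 2 * k + 1 + 1 = 2 * (k + 1) by ring, (hx (k+1)).1, (hx k).2]
    apply aux_abs_diff; simp

def auxTau : Equiv.Perm ℤ where
  toFun j := if Even j then j + 2 else j - 2
  invFun j := if Even j then j - 2 else j + 2
  left_inv j := by
    by_cases h : Even j <;> simp [h, Int.even_add, Int.even_sub]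
  right_inv j := by
    by_cases h : Even j <;> simp [h, Int.even_add, Int.even_sub]

theorem aux_tau_even (k : ℤ) : auxTau (2 * k) = 2 * k + 2 := by
  simp [auxTau]

theorem aux_tau_odd (k : ℤ) : auxTau (2 * k + 1) = 2 * k - 1 := by
  have h : ¬ Even (2 * k + 1) := by simp
  change (if Even (2 * k + 1) then _ else _) = _
  rw [if_neg h]; ring

theorem aux_x_tau {x : ℤ → ℝ} (hx : IsPos x) (j : ℤ) : |x (auxTau j) - x j| ≤ 1 := by
  rcases Int.even_or_odd' j with ⟨k, rfl | rfl⟩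
  · rw [aux_tau_even, show 2 * k + 2 = 2 * (k + 1) by ring, (hx k).1, (hx (k+1)).1]
    apply aux_abs_diff; simp
  · rw [aux_tau_odd, show 2 * k - 1 = 2 * (k - 1) + 1 by ring, (hx (k-1)).2, (hx k).2]
    apply aux_abs_diff; simp

theorem aux_B {x : ℤ → ℝ} (hx : IsPos x) {α : ℂ} (hα : ‖α‖ = 1) (j : ℤ) (B : Op)
    (hB : IsBj α j B) : ‖B‖ ≤ 2 ∧ ∃ K, IsXComm x B K ∧ ‖K‖ ≤ 2 := by
  obtain ⟨W, K, h1, h2, h3, h4⟩ := aux_W_comm (x := x) (Equiv.subRight (1 : ℤ))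
    (fun _ => α ^ (-j)) (by simp [hα]) (by
      intro i
      have := aux_x_succ hx (i - 1)
      rw [abs_sub_comm]
      simpa using this)
  obtain ⟨W', K', h1', h2', h3', h4'⟩ := aux_W_comm (x := x) (Equiv.addRight (1 : ℤ))
    (fun _ => α ^ j) (by simp [hα]) (by
      intro i
      simpa using aux_x_succ hx i)
  have e : B = W - W' := by
    apply aux_ext
    intro i
    rw [hB i, ContinuousLinearMap.sub_apply, h2, h2']
    simp
  subst e
  refine ⟨(norm_sub_le _ _).trans (by linarith), K - K', aux_comm_sub h3 h3',
    (norm_sub_le _ _).trans (by linarith)⟩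

theorem aux_C {x : ℤ → ℝ} (hx : IsPos x) {α : ℂ} (hα : ‖α‖ = 1) (j : ℤ) (C : Op)
    (hC : IsCj α j C) : ‖C‖ ≤ 1 ∧ ∃ K, IsXComm x C K ∧ ‖K‖ ≤ 1 := by
  obtain ⟨W, K, h1, h2, h3, h4⟩ := aux_W_comm (x := x) auxTau
    (fun i => if Even i then α ^ (2 * j) else α ^ (-(2 * j)))
    (by intro i; split_ifs <;> simp [hα]) (aux_x_tau hx)
  have e : C = W := by
    apply aux_ext
    intro i
    rw [h2]
    rcases Int.even_or_odd' i with ⟨k, rfl | rfl⟩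
    · rw [(hC k).1, aux_tau_even]; simp
    · have h : ¬ Even (2 * k + 1) := by simp
      rw [(hC k).2, aux_tau_odd, if_neg h]
  subst e
  exact ⟨h1, K, h3, h4⟩

open Classical in
theorem aux_card_mono (n l : ℕ) :
    (Finset.univ.filter fun f : Fin l → Fin n => StrictMono f).card = Nat.choose n l := by
  have h : Nat.card (Fin l ↪o Fin n) = Nat.choose n l := by
    rw [Nat.card_congr (Set.powersetCard.ofFinEmbEquiv (n := l) (I := Fin n))]
    rw [Set.powersetCard.card]; simp
  rw [← h, ← Fintype.card_subtype, ← Nat.card_eq_fintype_card]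
  exact Nat.card_congr
    { toFun := fun f => OrderEmbedding.ofStrictMono f.1 f.2
      invFun := fun f => ⟨f, f.strictMono⟩
      left_inv := fun f => rfl
      right_inv := fun f => by ext; rfl }

open Classical in
theorem aux_card_bool (l m : ℕ) :
    (Finset.univ.filter fun e : Fin l → Bool =>
      (Finset.univ.filter fun k => e k = true).card = m).card = Nat.choose l m := by
  have : Nat.choose l m = (Finset.powersetCard m (Finset.univ : Finset (Fin l))).card := by simp
  rw [this]
  refine Finset.card_bij' (fun e _ => Finset.univ.filter fun k => e k = true)
    (fun s _ => fun k => decide (k ∈ s)) ?_ ?_ ?_ ?_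
  · intro e he; simpa [Finset.mem_powersetCard] using he
  · intro s hs; simpa [Finset.mem_powersetCard] using hs
  · intro e he; ext k; simp
  · intro s hs; ext k; simp

/-- Lemma 4.2: `‖[X, S^{ℓ,m}_{[0,n-1]}]‖ ≤ 2^{ℓ-m} ℓ C(n,ℓ) C(ℓ,m)`. -/
theorem stmt12 (n : ℕ) (hn : 0 < n) (α : ℂ) (hα : IsAdmissible n α)
    (Bf Cf : ℤ → Op) (hBf : ∀ j : ℤ, IsBj α j (Bf j)) (hCf : ∀ j : ℤ, IsCj α j (Cf j))
    (x : ℤ → ℝ) (hx : IsPos x)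
    (l m : ℕ) (hm : m ≤ l) (hl : l ≤ n)
    (K : Op) (hK : IsXComm x (Sop Bf Cf 0 n l m) K) :
    ‖K‖ ≤ (2 : ℝ) ^ (l - m) * (l : ℝ) * (Nat.choose n l : ℝ) * (Nat.choose l m : ℝ) := by
  classical
  have hα1 : ‖α‖ = 1 := by
    obtain ⟨_, k, _, _, rfl⟩ := hα
    exact Complex.norm_exp_ofReal_mul_I _
  have key := aux_comm_sum (x := x)
    (Finset.univ : Finset ((Fin l → Fin n) × (Fin l → Bool)))
    (fun p => if StrictMono p.1 ∧ (∀ k, 0 ≤ (p.1 k : ℕ)) ∧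
        (Finset.univ.filter fun k => p.2 k = true).card = m then
      (List.ofFn fun k : Fin l =>
        if p.2 k = true then Cf ((p.1 k : ℕ) : ℤ) else Bf ((p.1 k : ℕ) : ℤ)).prod
    else 0)
    (fun p => if StrictMono p.1 ∧
        (Finset.univ.filter fun k => p.2 k = true).card = m then (l : ℝ) * 2 ^ (l - m) else 0)
    (by
      intro p _
      by_cases hp : StrictMono p.1 ∧ (Finset.univ.filter fun k => p.2 k = true).card = m
      · have hp' : StrictMono p.1 ∧ (∀ k, 0 ≤ (p.1 k : ℕ)) ∧
          (Finset.univ.filter fun k => p.2 k = true).card = m :=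
          ⟨hp.1, fun k => Nat.zero_le _, hp.2⟩
        simp only [if_pos hp, if_pos hp']
        have := (aux_list (x := x) l
          (fun k => if p.2 k = true then Cf ((p.1 k : ℕ) : ℤ) else Bf ((p.1 k : ℕ) : ℤ))
          (fun k => if p.2 k = true then 1 else 2)
          (by
            intro k
            split_ifs
            · exact (aux_C hx hα1 _ _ (hCf _)).1
            · exact (aux_B hx hα1 _ _ (hBf _)).1)
          (by
            intro k
            split_ifs
            · exact (aux_C hx hα1 _ _ (hCf _)).2
            · exact (aux_B hx hα1 _ _ (hBf _)).2)).2
        have hcard : (Finset.univ.filter fun k => ¬ p.2 k = true).card = l - m := by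
          have := Finset.card_filter_add_card_filter_not (s := (Finset.univ : Finset (Fin l)))
            (fun k => p.2 k = true)
          rw [hp.2, Finset.card_univ, Fintype.card_fin] at this
          omega
        rw [Finset.prod_ite, Finset.prod_const_one, one_mul, Finset.prod_const, hcard] at this
        exact this
      · have hp' : ¬ (StrictMono p.1 ∧ (∀ k, 0 ≤ (p.1 k : ℕ)) ∧
          (Finset.univ.filter fun k => p.2 k = true).card = m) :=
          fun h => hp ⟨h.1, h.2.2⟩
        simp only [if_neg hp, if_neg hp']
        exact ⟨0, aux_comm_zero, by simp⟩)
  obtain ⟨K', hK', hn'⟩ := key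
  have hS : IsXComm x (Sop Bf Cf 0 n l m) K' := by
    unfold Sop
    convert hK'
  rw [aux_comm_unique hK hS]
  refine hn'.trans (le_of_eq ?_)
  rw [← Finset.sum_filter, Finset.sum_const, ← Finset.univ_product_univ,
    Finset.filter_product (s := (Finset.univ : Finset (Fin l → Fin n)))
      (t := (Finset.univ : Finset (Fin l → Bool))) (fun f => StrictMono f)
      (fun e => (Finset.univ.filter fun k => e k = true).card = m),
    Finset.card_product]
  have e1 := aux_card_mono n l
  have e2 := aux_card_bool l m
  rw [nsmul_eq_mul]
  push_cast
  have e1' : ((Finset.univ.filter fun f : Fin l → Fin n => StrictMono f).card : ℝ)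
      = (Nat.choose n l : ℝ) := by rw [← e1]
  have e2' : ((Finset.univ.filter fun e : Fin l → Bool =>
      (Finset.univ.filter fun k => e k = true).card = m).card : ℝ)
      = (Nat.choose l m : ℝ) := by rw [← e2]
  rw [e1', e2']
  ring
end
end

section
/- For every 0 ≤ ℓ ≤ n, the extreme elementary symmetric polynomials of operators commute with the periodic field: [S^{ℓ,0}_{[0,n−1]}, D_n] = 0 and [S^{ℓ,ℓ}_{[0,n−1]}, D_n] = 0. -/
noncomputable section

theorem esymm_strictMono {R : Type*} [CommRing R] {n l : ℕ} (a : Fin n → R) :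
    (∑ p ∈ (Finset.univ.filter fun p : Fin l → Fin n => StrictMono p), ∏ k, a (p k)) =
      ∑ s ∈ Finset.powersetCard l (Finset.univ : Finset (Fin n)), ∏ i ∈ s, a i := by
  refine Finset.sum_bij (fun p _ => Finset.univ.image p) ?_ ?_ ?_ ?_
  · intro p hp
    simp only [Finset.mem_filter, Finset.mem_univ, true_and] at hp
    simp [Finset.mem_powersetCard, Finset.card_image_of_injective _ hp.injective]
  · intro p hp q hq h
    simp only [Finset.mem_filter, Finset.mem_univ, true_and] at hp hq
    have hc : (Finset.univ.image p).card = l := by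
      simp [Finset.card_image_of_injective _ hp.injective]
    rw [Finset.orderEmbOfFin_unique hc (f := p) (fun x => by simp) hp]
    rw [Finset.orderEmbOfFin_unique hc (f := q) (fun x => by rw [h]; simp) hq]
  · intro s hs
    rw [Finset.mem_powersetCard] at hs
    refine ⟨s.orderEmbOfFin hs.2, ?_, ?_⟩
    · simp [(s.orderEmbOfFin hs.2).strictMono]
    · ext x
      have := Finset.range_orderEmbOfFin s hs.2
      have h2 : x ∈ Set.range (s.orderEmbOfFin hs.2) ↔ x ∈ (s : Set (Fin n)) := by rw [this]
      simpa using h2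
  · intro p hp
    simp only [Finset.mem_filter, Finset.mem_univ, true_and] at hp
    rw [Finset.prod_image (fun x _ y _ h => hp.injective h)]

theorem esymm_perm {R : Type*} [CommRing R] {n l : ℕ} (a : Fin n → R) (σ : Equiv.Perm (Fin n)) :
    (∑ p ∈ (Finset.univ.filter fun p : Fin l → Fin n => StrictMono p), ∏ k, a (σ (p k))) =
    (∑ p ∈ (Finset.univ.filter fun p : Fin l → Fin n => StrictMono p), ∏ k, a (p k)) := by
  rw [esymm_strictMono (fun i => a (σ i)), esymm_strictMono a]
  refine Finset.sum_bij (fun s _ => s.map σ.toEmbedding) ?_ ?_ ?_ ?_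
  · intro s hs
    simpa [Finset.mem_powersetCard] using hs
  · intro s _ t _ h
    exact Finset.map_injective _ h
  · intro s hs
    refine ⟨s.map σ.symm.toEmbedding, by simpa [Finset.mem_powersetCard] using hs, ?_⟩
    ext x; simp
  · intro s _
    simp

theorem semiconj_list {M : Type*} [Ring M] (D : M) : ∀ {l : ℕ} (f g : Fin l → M)
    (_ : ∀ k, D * f k = g k * D), D * (List.ofFn f).prod = (List.ofFn g).prod * D
  | 0, f, g, _ => by simp
  | l + 1, f, g, h => by
    rw [List.ofFn_succ, List.ofFn_succ, List.prod_cons, List.prod_cons, ← mul_assoc, h 0,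
      mul_assoc, semiconj_list D _ _ (fun k => h k.succ), mul_assoc]

theorem sym_comm {M : Type*} [Ring M] {n l : ℕ} (A : Fin n → M) (D : M)
    (hA : ∀ i j, A i * A j = A j * A i) (σ : Equiv.Perm (Fin n))
    (hD : ∀ j, D * A j = A (σ j) * D) :
    (∑ p ∈ (Finset.univ.filter fun p : Fin l → Fin n => StrictMono p),
      (List.ofFn fun k => A (p k)).prod) * D =
    D * (∑ p ∈ (Finset.univ.filter fun p : Fin l → Fin n => StrictMono p),
      (List.ofFn fun k => A (p k)).prod) := by
  letI : CommRing (Subring.closure (Set.range A)) :=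
    Subring.closureCommRingOfComm (by rintro _ ⟨i, rfl⟩ _ ⟨j, rfl⟩; exact hA i j)
  let φ : Subring.closure (Set.range A) →+* M := (Subring.closure (Set.range A)).subtype
  let a : Fin n → Subring.closure (Set.range A) := fun i => ⟨A i, Subring.subset_closure ⟨i, rfl⟩⟩
  have key : ∀ b : Fin n → Fin n, (∑ p ∈ (Finset.univ.filter fun p : Fin l → Fin n => StrictMono p),
      (List.ofFn fun k => A (b (p k))).prod) =
      φ (∑ p ∈ (Finset.univ.filter fun p : Fin l → Fin n => StrictMono p), ∏ k, a (b (p k))) := by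
    intro b
    rw [map_sum]
    refine Finset.sum_congr rfl fun p _ => ?_
    rw [← List.prod_ofFn, map_list_prod, List.map_ofFn]
    rfl
  have h2 := key σ
  rw [esymm_perm a σ] at h2
  replace h2 := h2.trans (key id).symm
  simp only [id] at h2
  conv_lhs => rw [← h2]
  rw [Finset.mul_sum, Finset.sum_mul]
  exact Finset.sum_congr rfl fun p _ => (semiconj_list D _ _ fun k => hD (p k)).symm

theorem op_ext_s16 {S T : Op} (h : ∀ j, S (δ j) = T (δ j)) : S = T := by
  ext1 f
  have hf : HasSum (fun i : ℤ => (f i) • δ i) f := by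
    have := lp.hasSum_single (p := 2) (by norm_num) f
    convert this using 2 with i
    rw [δ, ← lp.single_smul]; simp
  have h1 := hf.mapL S
  have h2 := hf.mapL T
  simp only [map_smul, h] at h1 h2
  exact h1.unique h2

theorem sop_zero (Bf Cf : ℤ → Op) (n l : ℕ) : Sop Bf Cf 0 n l 0 =
    ∑ p ∈ (Finset.univ.filter fun p : Fin l → Fin n => StrictMono p),
      (List.ofFn fun k => Bf ((p k : ℕ) : ℤ)).prod := by
  classical
  rw [Sop, Fintype.sum_prod_type, Finset.sum_filter]
  refine Finset.sum_congr rfl fun p _ => ?_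
  rw [Finset.sum_eq_single (fun _ => false)]
  · simp
  · intro b _ hb
    rw [if_neg]
    rintro ⟨-, -, h⟩
    apply hb
    funext k
    rw [Finset.card_eq_zero, Finset.filter_eq_empty_iff] at h
    simpa using h (Finset.mem_univ k)
  · simp

theorem sop_self (Bf Cf : ℤ → Op) (n l : ℕ) : Sop Bf Cf 0 n l l =
    ∑ p ∈ (Finset.univ.filter fun p : Fin l → Fin n => StrictMono p),
      (List.ofFn fun k => Cf ((p k : ℕ) : ℤ)).prod := by
  classical
  rw [Sop, Fintype.sum_prod_type, Finset.sum_filter]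
  refine Finset.sum_congr rfl fun p _ => ?_
  rw [Finset.sum_eq_single (fun _ => true)]
  · simp
  · intro b _ hb
    rw [if_neg]
    rintro ⟨-, -, h⟩
    apply hb
    funext k
    have h' : (Finset.univ.filter fun k => b k = true).card = (Finset.univ : Finset (Fin l)).card := by
      simpa using h
    rw [Finset.card_filter_eq_iff] at h'
    exact h' k (Finset.mem_univ k)
  · simp

theorem adm_pow {n : ℕ} (hn : 0 < n) {α : ℂ} (hα : IsAdmissible n α) : α ≠ 0 ∧ α ^ n = 1 := by
  obtain ⟨-, k, -, -, rfl⟩ := hα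
  refine ⟨Complex.exp_ne_zero _, ?_⟩
  rw [← Complex.exp_nat_mul, Complex.exp_eq_one_iff]
  refine ⟨k, ?_⟩
  have : (n : ℂ) ≠ 0 := by exact_mod_cast hn.ne'
  push_cast
  field_simp

theorem comm_sym_of {n : ℕ} (hn : 0 < n) (l : ℕ) (F : ℤ → Op) (D : Op)
    (hc : ∀ i j, F i * F j = F j * F i) (hD : ∀ j, D * F j = F (j + 1) * D) (hper : F n = F 0) :
    (∑ p ∈ (Finset.univ.filter fun p : Fin l → Fin n => StrictMono p),
      (List.ofFn fun k => F ((p k : ℕ) : ℤ)).prod) * D =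
    D * (∑ p ∈ (Finset.univ.filter fun p : Fin l → Fin n => StrictMono p),
      (List.ofFn fun k => F ((p k : ℕ) : ℤ)).prod) := by
  refine sym_comm (fun i : Fin n => F ((i : ℕ) : ℤ)) D (fun i j => hc _ _) (finRotate n) ?_
  intro j
  rw [hD]
  congr 1
  obtain ⟨m, rfl⟩ : ∃ m, n = m + 1 := ⟨n - 1, by omega⟩
  rw [coe_finRotate]
  split_ifs with h
  · subst h
    simpa using hper
  · push_cast; rfl

/-- Corollary 5.3, first part: for every `0 ≤ ℓ ≤ n`,
`[S^{ℓ,0}_{[0,n-1]}, D_n] = 0` and `[S^{ℓ,ℓ}_{[0,n-1]}, D_n] = 0`. -/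
theorem stmt16 (n : ℕ) (hn : 0 < n) (α : ℂ) (hα : IsAdmissible n α)
    (Bf Cf : ℤ → Op) (hBf : ∀ j : ℤ, IsBj α j (Bf j)) (hCf : ∀ j : ℤ, IsCj α j (Cf j))
    (D : Op) (hD : IsDn α D)
    (l : ℕ) (hl : l ≤ n) :
    Sop Bf Cf 0 n l 0 * D = D * Sop Bf Cf 0 n l 0 ∧
      Sop Bf Cf 0 n l l * D = D * Sop Bf Cf 0 n l l := by
  obtain ⟨h0, hαn⟩ := adm_pow hn hα
  have hαz : α ^ (n : ℤ) = 1 := by rw [zpow_natCast, hαn]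
  have hC1 : ∀ j i, Cf j (δ (2 * i)) = α ^ (2 * j) • δ (2 * i + 2) := fun j i => (hCf j i).1
  have hC2 : ∀ j i, Cf j (δ (2 * i + 1)) = α ^ (-(2 * j)) • δ (2 * i - 1) := fun j i => (hCf j i).2
  rw [sop_zero, sop_self]
  constructor
  · refine comm_sym_of hn l Bf D ?_ ?_ ?_
    · intro i j
      refine op_ext_s16 fun k => ?_
      simp only [ContinuousLinearMap.mul_apply, hBf _ _, map_sub, map_smul, smul_sub, smul_smul,
        add_sub_cancel_right, sub_add_cancel, mul_comm (α ^ (-j)), mul_comm (α ^ j)]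
      abel
    · intro j
      refine op_ext_s16 fun k => ?_
      simp only [ContinuousLinearMap.mul_apply, hBf _ _, hD _, map_sub, map_smul, smul_sub,
        smul_smul, ← zpow_add₀ h0]
      congr 3 <;> ring
    · refine op_ext_s16 fun k => ?_
      simp [hBf _ _, hαn]
  · refine comm_sym_of hn l Cf D ?_ ?_ ?_
    · intro i j
      refine op_ext_s16 fun k => ?_
      obtain ⟨m, rfl | rfl⟩ := Int.even_or_odd' k
      · have e : 2 * m + 2 = 2 * (m + 1) := by ring
        simp only [ContinuousLinearMap.mul_apply, hC1, e, map_smul, smul_smul,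
          mul_comm (α ^ (2 * i))]
      · have e : 2 * m - 1 = 2 * (m - 1) + 1 := by ring
        simp only [ContinuousLinearMap.mul_apply, hC2, e, map_smul, smul_smul,
          mul_comm (α ^ (-(2 * i)))]
    · intro j
      refine op_ext_s16 fun k => ?_
      obtain ⟨m, rfl | rfl⟩ := Int.even_or_odd' k
      · simp only [ContinuousLinearMap.mul_apply, hC1, hD _, map_smul, smul_smul, ← zpow_add₀ h0]
        congr 2; ring
      · simp only [ContinuousLinearMap.mul_apply, hC2, hD _, map_smul, smul_smul, ← zpow_add₀ h0]
        congr 2; ring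
    · refine op_ext_s16 fun k => ?_
      have e : α ^ (2 * (n : ℤ)) = 1 := by rw [mul_comm, zpow_mul, hαz, one_zpow]
      obtain ⟨m, rfl | rfl⟩ := Int.even_or_odd' k
      · simp only [hC1, e]; simp
      · simp only [hC2, zpow_neg, e]; simp
end
end
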